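/- arXiv:2502.02219 — 4 statements merged into one kernel-verified Lean document; each statement's English description precedes it below -/
import Mathlib

section
/- Let q = 3^h, let F_q be the field with q elements and L a field extension of F_q with q^4 elements. Write Tr4(x) = x + x^q + x^(q^2) + x^(q^3) (the trace from L to F_q) and Tr2(x) = x + x^(q^2) (the trace from L to its subfield with q^2 elements). Suppose α, β ∈ L satisfy Tr4(α^(q+1)) + Tr2(α^(q^2+1)) = 0, Tr4(β^(q+1)) + Tr2(β^(q^2+1)) = 0, and Tr4(α·β^q + α·β^(q^2) + α·β^(q^3)) = 0. Then 1, α, β are F_q-linearly dependent in L. -/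
/-- The trace `Tr4(x) = x + x^q + x^(q^2) + x^(q^3)` from `F_{q^4}` to `F_q`. -/
def tr4 (q : ℕ) {L : Type*} [CommRing L] (u : L) : L := u + u ^ q + u ^ q ^ 2 + u ^ q ^ 3

/-- The trace `Tr2(x) = x + x^(q^2)` from `F_{q^4}` to `F_{q^2}`. -/
def tr2 (q : ℕ) {L : Type*} [CommRing L] (u : L) : L := u + u ^ q ^ 2

section FiniteField

variable {K L : Type*} [Field K] [Fintype K] [Field L] [Fintype L] [Algebra K L]

theorem tr4_eq_algebraMap_trace (hL : Module.finrank K L = 4) (x : L) :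
    tr4 (Fintype.card K) x = algebraMap K L (Algebra.trace K L x) := by
  rw [FiniteField.algebraMap_trace_eq_sum_pow, hL, Nat.card_eq_fintype_card]
  simp [tr4, Finset.sum_range_succ]

theorem pow_card_pow_four (hL : Module.finrank K L = 4) (x : L) :
    x ^ Fintype.card K ^ 4 = x := by
  rw [← hL, ← Module.card_eq_pow_finrank, FiniteField.pow_card]

/-- The polarization of the second elementary symmetric function of the conjugates. -/
theorem trace_mul_eq_of_tr4_eq_zero (hL : Module.finrank K L = 4) {x y : L}
    (h : tr4 (Fintype.card K) (x * y ^ Fintype.card K + x * y ^ Fintype.card K ^ 2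
      + x * y ^ Fintype.card K ^ 3) = 0) :
    Algebra.trace K L (x * y) = Algebra.trace K L x * Algebra.trace K L y := by
  have hy : y ^ Fintype.card K + y ^ Fintype.card K ^ 2 + y ^ Fintype.card K ^ 3 =
      algebraMap K L (Algebra.trace K L y) - y := by
    rw [← tr4_eq_algebraMap_trace hL, tr4]
    ring
  rw [← mul_add, ← mul_add, hy, tr4_eq_algebraMap_trace hL, map_eq_zero, mul_sub, map_sub,
    mul_comm x (algebraMap K L _), ← Algebra.smul_def, map_smul, smul_eq_mul, sub_eq_zero] at h
  rw [← h, mul_comm]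

theorem trace_sq_eq_of_tr4_add_tr2_eq_zero (hL : Module.finrank K L = 4) {x : L}
    (h : tr4 (Fintype.card K) (x ^ (Fintype.card K + 1))
      + tr2 (Fintype.card K) (x ^ (Fintype.card K ^ 2 + 1)) = 0) :
    Algebra.trace K L (x * x) = Algebra.trace K L x * Algebra.trace K L x := by
  apply trace_mul_eq_of_tr4_eq_zero hL
  have h4 := pow_card_pow_four (K := K) hL x
  have hσ (y : L) : y ^ Fintype.card K = FiniteField.frobeniusAlgHom K L y := rfl
  have h' := congrArg (FiniteField.frobeniusAlgHom K L) h
  simp only [tr4, tr2, pow_succ, pow_zero, one_mul, pow_mul, hσ, map_add, map_mul, map_zero]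
    at h h' h4 ⊢
  simp only [h4] at h h' ⊢
  linear_combination h + h'

end FiniteField

/-- Section 5.1 of the paper: for `q = 3^h`, there are no `α, β ∈ F_{q^4}`
satisfying the displayed trace conditions with `1, α, β` linearly independent over `F_q`. -/
theorem statement15 {h q : ℕ} (hq : q = 3 ^ h)
    (Fq : Type*) [Field Fq] [Fintype Fq] (hcardq : Fintype.card Fq = q)
    (L : Type*) [Field L] [Fintype L] [Algebra Fq L] (hcardL : Fintype.card L = q ^ 4)
    (α β : L)
    (hα : tr4 q (α ^ (q + 1)) + tr2 q (α ^ (q ^ 2 + 1)) = 0)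
    (hβ : tr4 q (β ^ (q + 1)) + tr2 q (β ^ (q ^ 2 + 1)) = 0)
    (hαβ : tr4 q (α * β ^ q + α * β ^ q ^ 2 + α * β ^ q ^ 3) = 0) :
    ¬ LinearIndependent Fq ![(1 : L), α, β] := by
  subst hcardq
  intro hli
  have hL : Module.finrank Fq L = 4 :=
    Nat.pow_right_injective (Fintype.one_lt_card (α := Fq))
      (Module.card_eq_pow_finrank.symm.trans hcardL)
  have h3 : (3 : Fq) = 0 := by
    have h0 : ((3 ^ h : ℕ) : Fq) = 0 := hq ▸ FiniteField.cast_card_eq_zero Fq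
    exact_mod_cast eq_zero_of_pow_eq_zero (n := h) (by exact_mod_cast h0)
  have hαα := trace_sq_eq_of_tr4_add_tr2_eq_zero hL hα
  have hββ := trace_sq_eq_of_tr4_add_tr2_eq_zero hL hβ
  have hαβ' := trace_mul_eq_of_tr4_eq_zero hL hαβ
  have h1 : Algebra.trace Fq L 1 = 1 := by
    have := Algebra.trace_algebraMap (R := Fq) (S := L) 1
    rw [hL, map_one] at this
    rw [this]
    simp only [nsmul_eq_mul]
    push_cast
    linear_combination h3
  have horth : ∀ x y : L, Algebra.trace Fq L (y * x) = Algebra.trace Fq L y * Algebra.trace Fq L x →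
      Algebra.traceForm Fq L y (x - Algebra.trace Fq L x • 1) = 0 := by
    intro x y hxy
    simp [Algebra.traceForm_apply, mul_sub, hxy, mul_comm (Algebra.trace Fq L x)]
  set W := Submodule.span Fq (Set.range ![(1 : L), α, β])
  have hWrank : Module.finrank Fq W = 3 := by
    simpa using finrank_span_eq_card hli
  have hWorth := LinearMap.BilinForm.finrank_orthogonal (B := Algebra.traceForm Fq L)
    (traceForm_nondegenerate Fq L) W
  rw [hL, hWrank] at hWorth
  have hmem : ∀ x : L, (∀ i, Algebra.trace Fq L (![(1 : L), α, β] i * x) =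
      Algebra.trace Fq L (![(1 : L), α, β] i) * Algebra.trace Fq L x) →
      x - Algebra.trace Fq L x • 1 ∈ (Algebra.traceForm Fq L).orthogonal W := by
    intro x hx
    rw [LinearMap.BilinForm.mem_orthogonal_iff]
    intro y hy
    induction hy using Submodule.span_induction with
    | mem y hy => obtain ⟨i, rfl⟩ := hy; exact horth _ _ (hx i)
    | zero => simp
    | add y z _ _ hy hz => rw [map_add, LinearMap.add_apply, hy, hz, add_zero]
    | smul c y _ hy => rw [map_smul, LinearMap.smul_apply, hy, smul_zero]
  have hmα := hmem α (by
    intro i; fin_cases i <;> simp [h1, hαα, mul_comm β α, hαβ', mul_comm])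
  have hmβ := hmem β (by
    intro i; fin_cases i <;> simp [h1, hββ, hαβ'])
  have hpair : LinearIndependent Fq
      ![(⟨_, hmα⟩ : (Algebra.traceForm Fq L).orthogonal W), ⟨_, hmβ⟩] := by
    rw [LinearIndependent.pair_iff]
    intro s t hst
    have hst' := congrArg Subtype.val hst
    have := Fintype.linearIndependent_iff.mp hli
      ![-(s * Algebra.trace Fq L α + t * Algebra.trace Fq L β), s, t] (by
        simp only [Fin.sum_univ_three, Submodule.coe_add, Submodule.coe_smul,
          Submodule.coe_zero] at hst' ⊢
        rw [← hst']
        simp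
        module)
    exact ⟨this 1, this 2⟩
  have := hpair.fintype_card_le_finrank
  simp at this
  omega
end

section
/- Let q = 3^h and let μ ∈ F_q be a nonsquare (there is no ν ∈ F_q with ν^2 = μ). Define f1, f2, f3 : F_q^3 → F_q by f1(X,Y,Z) = Z, f2(X,Y,Z) = -μ·Y^3 + X^2·Y - X·Z, f3(X,Y,Z) = -μ^{-1}·X^3 + X·Y^2 + Y·Z. Then the ovoid condition holds: for all distinct triples (x1,y1,z1), (x2,y2,z2) ∈ F_q^3, (x1-x2)(f3(x2,y2,z2)-f3(x1,y1,z1)) + (y1-y2)(f2(x2,y2,z2)-f2(x1,y1,z1)) + (z1-z2)(f1(x2,y2,z2)-f1(x1,y1,z1)) ≠ 0; that is, O_7(f1,f2,f3) is an ovoid of Q (the Thas–Kantor ovoid). -/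
/-- The ovoid condition for `O_7(f1,f2,f3)`. -/
def ovoidCondition {F : Type*} [Field F] (f1 f2 f3 : F → F → F → F) : Prop :=
  ∀ x1 y1 z1 x2 y2 z2 : F, (x1, y1, z1) ≠ (x2, y2, z2) →
    (x1 - x2) * (f3 x2 y2 z2 - f3 x1 y1 z1) +
      (y1 - y2) * (f2 x2 y2 z2 - f2 x1 y1 z1) +
      (z1 - z2) * (f1 x2 y2 z2 - f1 x1 y1 z1) ≠ 0

theorem eq_zero_of_mul_sq_eq_sq {F : Type*} [Field F] {μ s t : F} (hμ : ∀ ν : F, ν ^ 2 ≠ μ)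
    (h : μ * s ^ 2 = t ^ 2) : s = 0 ∧ t = 0 := by
  have hs : s = 0 := by
    by_contra hs
    apply hμ (t / s)
    rw [div_pow, ← h]
    field_simp
  refine ⟨hs, ?_⟩
  simpa [hs] using h.symm

/-- In characteristic `3` the ovoid form of the Thas–Kantor functions, multiplied by `-μ`,
is a difference `μ * s ^ 2 - t ^ 2`. -/
theorem thasKantor_form_eq {F : Type*} [Field F] (h3 : (3 : F) = 0) {μ : F} (hμ : μ ≠ 0)
    (x1 y1 z1 x2 y2 z2 : F) :
    -μ * ((x1 - x2) * ((-μ⁻¹ * x2 ^ 3 + x2 * y2 ^ 2 + y2 * z2) -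
          (-μ⁻¹ * x1 ^ 3 + x1 * y1 ^ 2 + y1 * z1)) +
        (y1 - y2) * ((-μ * y2 ^ 3 + x2 ^ 2 * y2 - x2 * z2) -
          (-μ * y1 ^ 3 + x1 ^ 2 * y1 - x1 * z1)) +
        (z1 - z2) * (z2 - z1)) =
      μ * ((z2 - z1) + ((x2 - x1) * (y1 + y2) - (y2 - y1) * (x1 + x2))) ^ 2 -
        ((x2 - x1) ^ 2 - μ * (y2 - y1) ^ 2) ^ 2 := by
  have hinv : μ * μ⁻¹ = 1 := mul_inv_cancel₀ hμ
  grind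

/-- Section 3.2 of the paper: the Thas–Kantor ovoid for `q = 3^h`. -/
theorem statement17 {h q : ℕ} (hq : q = 3 ^ h)
    (Fq : Type*) [Field Fq] [Fintype Fq] (hcard : Fintype.card Fq = q)
    (μ : Fq) (hμ : ∀ ν : Fq, ν ^ 2 ≠ μ)
    (f1 f2 f3 : Fq → Fq → Fq → Fq)
    (hf1 : ∀ x y z : Fq, f1 x y z = z)
    (hf2 : ∀ x y z : Fq, f2 x y z = -μ * y ^ 3 + x ^ 2 * y - x * z)
    (hf3 : ∀ x y z : Fq, f3 x y z = -μ⁻¹ * x ^ 3 + x * y ^ 2 + y * z) :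
    ovoidCondition f1 f2 f3 := by
  have h3 : (3 : Fq) = 0 := by
    have hc : ((Fintype.card Fq : ℕ) : Fq) = 0 := Nat.cast_card_eq_zero Fq
    rw [hcard, hq] at hc
    push_cast at hc
    exact eq_zero_of_pow_eq_zero hc
  have hμ0 : μ ≠ 0 := fun h0 => hμ 0 (by simp [h0])
  intro x1 y1 z1 x2 y2 z2 hne hE
  simp only [hf1, hf2, hf3] at hE
  have hform := thasKantor_form_eq h3 hμ0 x1 y1 z1 x2 y2 z2
  rw [hE, mul_zero] at hform
  obtain ⟨hs, ht⟩ := eq_zero_of_mul_sq_eq_sq hμ (sub_eq_zero.mp hform.symm)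
  obtain ⟨hy, hx⟩ := eq_zero_of_mul_sq_eq_sq hμ (sub_eq_zero.mp ht).symm
  rw [hx, hy, zero_mul, zero_mul, sub_zero, add_zero] at hs
  exact hne (by rw [sub_eq_zero.mp hx, sub_eq_zero.mp hy, sub_eq_zero.mp hs])
end

section
/- Let q = 3^(2h+1) with h ≥ 1 and set σ = 3^(h+1) (so σ^2 = 3q). Define f1, f2, f3 : F_q^3 → F_q by f1(X,Y,Z) = Z, f2(X,Y,Z) = -X^(σ+3) + Y^σ + X^2·Y - X·Z, f3(X,Y,Z) = -X^(2σ+3) + X^σ·Y^σ - Z^σ + X·Y^2 + Y·Z. Then the ovoid condition holds: for all distinct triples (x1,y1,z1), (x2,y2,z2) ∈ F_q^3, (x1-x2)(f3(x2,y2,z2)-f3(x1,y1,z1)) + (y1-y2)(f2(x2,y2,z2)-f2(x1,y1,z1)) + (z1-z2)(f1(x2,y2,z2)-f1(x1,y1,z1)) ≠ 0; that is, O_7(f1,f2,f3) is an ovoid of Q (the Ree–Tits ovoid). -/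
section ReeNorm

variable {F : Type*} [Field F]

/-- The norm function of the Ree group over a field with a Tits endomorphism `s`. -/
def reeNorm (s : F →+* F) (x y z : F) : F :=
  z ^ 2 + y * s y - x ^ 2 * y ^ 2 - x ^ 3 * s x * y + x * s x * s y - x * s z - x ^ 4 * s x ^ 2

variable [CharP F 3] in
/-- The linear combination of differences in the ovoid condition is, up to sign, the Ree norm of
the quotient of the two points in the Ree root group. -/
theorem reeNorm_quotient (s : F →+* F) (hs : ∀ x, s (s x) = x ^ 3) (x y z a b c : F) :
    reeNorm s a (b - a * s x) (c + x * b - y * a) =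
      a * ((-(s (x + a) ^ 2 * (x + a) ^ 3) + s (x + a) * s (y + b) - s (z + c)
          + (x + a) * (y + b) ^ 2 + (y + b) * (z + c))
        - (-(s x ^ 2 * x ^ 3) + s x * s y - s z + x * y ^ 2 + y * z)) +
      b * ((-(s (x + a) * (x + a) ^ 3) + s (y + b) + (x + a) ^ 2 * (y + b)
          - (x + a) * (z + c))
        - (-(s x * x ^ 3) + s y + x ^ 2 * y - x * z)) +
      c * c := by
  simp only [reeNorm, map_add, map_sub, map_mul, hs]
  grind

theorem reeNorm_smul (s : F →+* F) (hs : ∀ x, s (s x) = x ^ 3) (x y z : F) :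
    reeNorm s x (x * s x * y) (x ^ 2 * s x * z) = x ^ 4 * s x ^ 2 * reeNorm s 1 y z := by
  simp only [reeNorm, map_mul, map_pow, map_one, hs]
  ring

variable [CharP F 3]

/-- The system to which the vanishing of the Ree norm at first coordinate `1` reduces. -/
theorem ree_system_inconsistent (s : F →+* F) (hs : ∀ x, s (s x) = x ^ 3) (v w : F)
    (h1 : v * s v = v - w ^ 2) (h2 : s w + s v = w * v - 1) : False := by
  have h1' : v ^ 3 * s v = s v - s w ^ 2 := by
    have := congrArg s h1
    simp only [map_mul, map_sub, map_pow, hs] at this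
    linear_combination this
  have h2' : w ^ 3 + v ^ 3 = s w * s v - 1 := by
    have := congrArg s h2
    simpa only [map_mul, map_add, map_sub, map_one, hs] using this
  have hW : s w = w * v - 1 - s v := by linear_combination h2
  rw [hW] at h2'
  rw [hW] at h1'
  have hv : v ≠ 0 := by
    rintro rfl
    have hw : w = 0 := by simpa using h1
    subst hw
    simp at h2
  have hfac : (w - v) * (w - v ^ 2) = 0 := by
    have : (w - v) ^ 3 * (w - v ^ 2) = 0 := by
      grind
    simp_all
  rcases mul_eq_zero.1 hfac with h | h
  · have hw : w = v := by linear_combination h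
    subst hw
    have hC : s w = 1 - w := mul_left_cancel₀ hv (by linear_combination h1)
    have hw1 : w = 1 := mul_left_cancel₀ hv (by grind)
    subst hw1
    simp at hC
  · have hw : w = v ^ 2 := by linear_combination h
    subst hw
    have hC : s v = 1 - v ^ 3 := mul_left_cancel₀ hv (by linear_combination h1)
    rw [map_pow] at hW
    have hv0 : s v ≠ 0 := by simpa using hv
    have hC1 : s v = 1 := mul_left_cancel₀ hv0 (by grind)
    rw [hC1] at hC
    exact hv (pow_eq_zero_iff (n := 3) (by norm_num) |>.1 (by linear_combination hC))

theorem reeNorm_one_ne_zero (s : F →+* F) (hs : ∀ x, s (s x) = x ^ 3) (y z : F) :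
    reeNorm s 1 y z ≠ 0 := by
  intro h
  simp only [reeNorm, map_one] at h
  have h' := congrArg s h
  simp only [map_add, map_sub, map_mul, map_pow, map_one, map_zero, hs] at h'
  have hA : s z = z ^ 2 + y * s y - y ^ 2 - y + s y - 1 := by linear_combination -h
  rw [hA] at h'
  have hfac : (y * (s y - 1) + (z + y) ^ 2) *
      ((y - 1) * (s y - 1) + (z + y) ^ 2 - (y + 1) * (z + y) + y ^ 2) = 0 := by
    grind
  rcases mul_eq_zero.1 hfac with h1 | h1
  · refine ree_system_inconsistent s hs y (z + y) (by linear_combination h1) ?_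
    rw [map_add]
    grind
  · refine ree_system_inconsistent s hs (1 - y) (z + y + y + 1) ?_ ?_
    · rw [map_sub, map_one]
      grind
    · simp only [map_add, map_sub, map_one]
      grind

theorem eq_zero_of_reeNorm_eq_zero (s : F →+* F) (hs : ∀ x, s (s x) = x ^ 3)
    (hsq : ∀ y z : F, y * s y = -z ^ 2 → y = 0) (x y z : F) (h : reeNorm s x y z = 0) :
    x = 0 ∧ y = 0 ∧ z = 0 := by
  by_cases hx : x = 0
  · subst hx
    simp only [reeNorm, map_zero] at h
    have hy : y = 0 := hsq y z (by linear_combination h)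
    subst hy
    refine ⟨rfl, rfl, ?_⟩
    simpa using h
  · have hsx : s x ≠ 0 := by simpa using hx
    have h' := reeNorm_smul s hs x (y / (x * s x)) (z / (x ^ 2 * s x))
    rw [mul_div_cancel₀ _ (mul_ne_zero hx hsx),
      mul_div_cancel₀ _ (mul_ne_zero (pow_ne_zero 2 hx) hsx), h] at h'
    exact absurd h'.symm (mul_ne_zero (mul_ne_zero (pow_ne_zero 4 hx) (pow_ne_zero 2 hsx))
      (reeNorm_one_ne_zero s hs _ _))

end ReeNorm


/-- Section 3.2 of the paper: the Ree–Tits ovoid for `q = 3^(2h+1)`,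
`σ = 3^(h+1)`. -/
theorem statement18 {h q σ : ℕ} (hh : 1 ≤ h) (hq : q = 3 ^ (2 * h + 1))
    (hσ : σ = 3 ^ (h + 1))
    (Fq : Type*) [Field Fq] [Fintype Fq] (hcard : Fintype.card Fq = q)
    (f1 f2 f3 : Fq → Fq → Fq → Fq)
    (hf1 : ∀ x y z : Fq, f1 x y z = z)
    (hf2 : ∀ x y z : Fq, f2 x y z = -x ^ (σ + 3) + y ^ σ + x ^ 2 * y - x * z)
    (hf3 : ∀ x y z : Fq, f3 x y z =
      -x ^ (2 * σ + 3) + x ^ σ * y ^ σ - z ^ σ + x * y ^ 2 + y * z) :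
    ovoidCondition f1 f2 f3 := by
  have hchar : CharP Fq 3 := by
    have : Fact (Nat.Prime 3) := ⟨Nat.prime_three⟩
    exact charP_of_card_eq_prime_pow (f := 2 * h + 1) (by rw [hcard, hq])
  let s : Fq →+* Fq := iterateFrobenius Fq 3 (h + 1)
  have hsσ : ∀ x, s x = x ^ σ := fun x => by
    rw [hσ]
    exact iterateFrobenius_def 3 (h + 1) x
  have hs : ∀ x, s (s x) = x ^ 3 := fun x => by
    have hexp : σ * σ = q * 3 := by
      rw [hσ, hq]
      ring
    rw [hsσ, hsσ, ← pow_mul, hexp, pow_mul, ← hcard, FiniteField.pow_card]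
  have hneg : ¬ IsSquare (-1 : Fq) := by
    rw [FiniteField.isSquare_neg_one_iff, hcard, hq, pow_succ, pow_mul, not_not, Nat.mul_mod,
      Nat.pow_mod]
    norm_num
  have hsq : ∀ y z : Fq, y * s y = -z ^ 2 → y = 0 := by
    intro y z hyz
    by_contra hy
    obtain ⟨k, hk⟩ : Odd σ := hσ ▸ Odd.pow (by decide)
    have hyk : (y ^ (k + 1)) ^ 2 = -z ^ 2 := by
      rw [← hyz, hsσ, hk]
      ring
    have hz : z ≠ 0 := by
      rintro rfl
      simp [hy] at hyk
    refine hneg ⟨y ^ (k + 1) / z, ?_⟩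
    field_simp
    rw [hyk]
  intro x1 y1 z1 x2 y2 z2 hne hD
  have key := reeNorm_quotient s hs x1 y1 z1 (x2 - x1) (y2 - y1) (z2 - z1)
  simp only [add_sub_cancel] at key
  simp only [hf1, hf2, hf3, pow_add, two_mul, ← hsσ] at hD
  have hzero := key.trans (b := _) (c := 0) (by linear_combination -hD)
  obtain ⟨hx, hy, hz⟩ := eq_zero_of_reeNorm_eq_zero s hs hsq _ _ _ hzero
  rw [hx] at hy hz
  have hy' : y2 - y1 = 0 := by linear_combination hy
  rw [hy'] at hz
  apply hne
  rw [sub_eq_zero.1 hx, sub_eq_zero.1 hy', sub_eq_zero.1 (show z2 - z1 = 0 by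
    linear_combination hz)]
end

section
/- Let F_8 be the finite field with 8 elements and define f1, f2, f3 : F_8^3 → F_8 by f1(X,Y,Z) = X + Y + Z + X^2·Y + X^4·Y^2 + X·Y^2 + X^2·Y^4 + X^4·Y^4, f2(X,Y,Z) = Y + X^2·Z + X^4·Z^2 + X·Z^2 + X^2·Z^4 + X^4·Z^4, f3(X,Y,Z) = X + Y + Y^2·Z + Y^4·Z^2 + Y·Z^2 + Y^2·Z^4 + Y^4·Z^4. Then the ovoid condition holds: for all distinct triples (x1,y1,z1), (x2,y2,z2) ∈ F_8^3, (x1-x2)(f3(x2,y2,z2)-f3(x1,y1,z1)) + (y1-y2)(f2(x2,y2,z2)-f2(x1,y1,z1)) + (z1-z2)(f1(x2,y2,z2)-f1(x1,y1,z1)) ≠ 0; that is, O_7(f1,f2,f3) is an ovoid of Q (the Dye ovoid for q = 8). -/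
section CardEight

variable {F : Type*} [Field F]

theorem charP_two_of_card_eq_eight [Fintype F] (hcard : Fintype.card F = 8) : CharP F 2 := by
  have h8 : ((8 : ℕ) : F) = 0 := hcard ▸ Nat.cast_card_eq_zero F
  have h2 : (2 : F) ^ 3 = 0 := by
    push_cast at h8
    linear_combination h8
  exact CharTwo.of_one_ne_zero_of_two_eq_zero one_ne_zero (eq_zero_of_pow_eq_zero h2)

/-- The additive polynomial `u x + u⁴ x² + (u + u⁴) x⁴`. For `u = b c (b + c)` in a field with `8`
elements, it is the part of the ovoid form that depends on the base point. -/
def shiftPoly (u x : F) : F := u * x + u ^ 4 * x ^ 2 + (u + u ^ 4) * x ^ 4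

theorem shiftPoly_zero_left (x : F) : shiftPoly 0 x = 0 := by
  simp [shiftPoly]

variable [CharP F 2]

theorem shiftPoly_add_right (u x y : F) :
    shiftPoly u (x + y) = shiftPoly u x + shiftPoly u y := by
  unfold shiftPoly
  grind

theorem trace_shiftPoly (hF : ∀ x : F, x ^ 8 = x) (u x : F) :
    shiftPoly u x + shiftPoly u x ^ 2 + shiftPoly u x ^ 4 = 0 := by
  have hu := hF u
  have hx := hF x
  unfold shiftPoly
  grind

/-- If `s` has trace zero over `𝔽₂`, then `s ^ 3 + s + 1 = 0` and `shiftPoly (s ^ 5) x` is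
`s ^ 4 * Tr (s * x)`, which is never `s`. -/
theorem add_shiftPoly_pow_five_ne_zero (hF : ∀ x : F, x ^ 8 = x) {s : F} (hs : s ≠ 0) (x : F) :
    s + shiftPoly (s ^ 5) x ≠ 0 := by
  intro h
  have hs7 : s ^ 7 = 1 := mul_left_cancel₀ hs (by rw [← pow_succ', hF s, mul_one])
  have hs20 : (s ^ 5) ^ 4 = s ^ 6 := by grind
  rw [shiftPoly, hs20] at h
  have hx := hF x
  have htr : s * (s ^ 3 + s + 1) = 0 := by grind
  have hs3 : s ^ 3 + s + 1 = 0 := (mul_eq_zero.mp htr).resolve_left hs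
  have ht : (s * x + s ^ 2 * x ^ 2 + s ^ 4 * x ^ 4) *
      (s * x + s ^ 2 * x ^ 2 + s ^ 4 * x ^ 4 + 1) = 0 := by
    grind
  have h' : s * (1 + s ^ 3 * (s * x + s ^ 2 * x ^ 2 + s ^ 4 * x ^ 4)) = 0 := by grind
  grind

theorem planeForm_ne_zero (hF : ∀ x : F, x ^ 8 = x) {a b : F} (hab : a ≠ 0 ∨ b ≠ 0) (x : F) :
    a ^ 2 + a * b + b ^ 2 + shiftPoly (a * b * (a + b)) x ≠ 0 := by
  by_cases ha : a = 0
  · subst ha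
    simpa [shiftPoly] using hab
  by_cases hb : b = 0
  · subst hb
    simpa [shiftPoly] using hab
  by_cases hc : a + b = 0
  · obtain rfl : a = b := by grind
    rw [hc, mul_zero, shiftPoly_zero_left]
    grind
  set s := a ^ 2 + a * b + b ^ 2 with hs
  set u := a * b * (a + b) with hu
  have ha' : (s ^ 3 + u ^ 2) * a + (1 + s ^ 2 * u) = 0 := by
    refine (mul_eq_zero.mp ?_).resolve_left ha
    have := hF a
    grind
  have hb' : (s ^ 3 + u ^ 2) * b + (1 + s ^ 2 * u) = 0 := by
    refine (mul_eq_zero.mp ?_).resolve_left hb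
    have := hF b
    grind
  clear_value s u
  have hsu : s ^ 3 + u ^ 2 = 0 := by
    refine (mul_eq_zero.mp ?_).resolve_right hc
    grind
  have hsu' : s ^ 2 * u = 1 := by grind
  have hs0 : s ≠ 0 := by
    rintro h
    simp [h] at hsu'
  have hs8 := hF s
  have hus : u = s ^ 5 := by
    have : s ^ 2 * (u - s ^ 5) = 0 := by grind
    grind
  rw [hus]
  exact add_shiftPoly_pow_five_ne_zero hF hs0 x

/-- Over `𝔽₂`, the product of the nonzero linear forms in `a, b, c` is their Moore determinant. -/
theorem moore_eq (a b c : F) :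
    a * b * c * (a + b) * (a + c) * (b + c) * (a + b + c) =
      a * b ^ 2 * c ^ 4 + a * b ^ 4 * c ^ 2 + a ^ 2 * b * c ^ 4 + a ^ 2 * b ^ 4 * c +
        a ^ 4 * b * c ^ 2 + a ^ 4 * b ^ 2 * c := by
  grind

theorem trace_eq_zero_of_moore_ne_zero (hF : ∀ x : F, x ^ 8 = x) {a b c t : F}
    (hD : a * b * c * (a + b) * (a + c) * (b + c) * (a + b + c) ≠ 0)
    (ht : t = a + b + c + a * b + a * c + b * c + a * b * c * (a + b + c)) :
    t + t ^ 2 + t ^ 4 = 0 := by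
  refine (mul_eq_zero.mp ?_).resolve_left hD
  have ht2 : t ^ 2 = a ^ 2 + b ^ 2 + c ^ 2 + a ^ 2 * b ^ 2 + a ^ 2 * c ^ 2 + b ^ 2 * c ^ 2 +
      a ^ 4 * b ^ 2 * c ^ 2 + a ^ 2 * b ^ 4 * c ^ 2 + a ^ 2 * b ^ 2 * c ^ 4 := by
    clear hD
    grind
  have ha := hF a
  have hb := hF b
  have hc := hF c
  have ht4 : t ^ 4 = a ^ 4 + b ^ 4 + c ^ 4 + a ^ 4 * b ^ 4 + a ^ 4 * c ^ 4 + b ^ 4 * c ^ 4 +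
      a * b ^ 4 * c ^ 4 + a ^ 4 * b * c ^ 4 + a ^ 4 * b ^ 4 * c := by
    rw [show t ^ 4 = (t ^ 2) ^ 2 by ring, ht2]
    clear hD ht ht2
    grind
  rw [moore_eq, ht2, ht4, ht]
  clear hD ht ht2 ht4
  grind

theorem moore_eq_one (hF : ∀ x : F, x ^ 8 = x) {a b c : F}
    (hD : a * b * c * (a + b) * (a + c) * (b + c) * (a + b + c) ≠ 0) :
    a * b * c * (a + b) * (a + c) * (b + c) * (a + b + c) = 1 := by
  rw [moore_eq] at hD ⊢
  have ha := hF a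
  have hb := hF b
  have hc := hF c
  refine mul_left_cancel₀ hD ?_
  clear hD
  grind

/-- The form of the ovoid condition at the points `(x + a, y + b, z + c)` and `(x, y, z)`. -/
def ovoidForm (a b c x y z : F) : F :=
  a ^ 2 + b ^ 2 + c ^ 2 + a * b + a * c + b * c +
    a * b * c * (a + b) * (a + c) * (b + c) * (a + b + c) +
    (a * b ^ 4 * c ^ 4 + a ^ 4 * b * c ^ 4 + a ^ 4 * b ^ 4 * c) +
    (shiftPoly (b * c * (b + c)) x + shiftPoly (a * c * (a + c)) y +
      shiftPoly (a * b * (a + b)) z)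

theorem ovoidForm_ne_zero_of_moore_ne_zero (hF : ∀ x : F, x ^ 8 = x) {a b c : F}
    (hD : a * b * c * (a + b) * (a + c) * (b + c) * (a + b + c) ≠ 0) (x y z : F) :
    ovoidForm a b c x y z ≠ 0 := by
  intro h
  have hx := trace_shiftPoly hF (b * c * (b + c)) x
  have hy := trace_shiftPoly hF (a * c * (a + c)) y
  have hz := trace_shiftPoly hF (a * b * (a + b)) z
  have hN := trace_eq_zero_of_moore_ne_zero hF hD rfl
  rw [ovoidForm, moore_eq_one hF hD] at h
  clear hD
  generalize shiftPoly (b * c * (b + c)) x = X at *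
  generalize shiftPoly (a * c * (a + c)) y = Y at *
  generalize shiftPoly (a * b * (a + b)) z = Z at *
  have ha := hF a
  have hb := hF b
  have hc := hF c
  set r := a * b ^ 4 * c ^ 4 + a ^ 4 * b * c ^ 4 + a ^ 4 * b ^ 4 * c with hr
  set n := a + b + c with hn
  set e := a * b + a * c + b * c with he
  have hq : a ^ 2 + b ^ 2 + c ^ 2 = n ^ 2 := by grind
  have hr2 : r ^ 2 = a * b * c * n := by
    rw [hr, hn]
    clear_value r n e
    clear hx hy hz hN h hr hn he hq
    grind
  have hn8 := hF n
  have hr8 := hF r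
  have hT : n + e + r ^ 2 + (n + e + r ^ 2) ^ 2 + (n + e + r ^ 2) ^ 4 = 0 := by
    rw [hr2, ← hN, he]
    ring
  have h0 : n ^ 2 + e + 1 + r + X + Y + Z = 0 := by
    rw [← h, ← hq, he]
    ring
  clear_value r n e
  clear h hN hr hn he hq hr2 ha hb hc
  grind

theorem ovoidForm_ne_zero (hF : ∀ x : F, x ^ 8 = x) {a b c : F}
    (habc : a ≠ 0 ∨ b ≠ 0 ∨ c ≠ 0) (x y z : F) : ovoidForm a b c x y z ≠ 0 := by
  by_cases hD : a * b * c * (a + b) * (a + c) * (b + c) * (a + b + c) = 0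
  · have hplane (p q w : F) (hpq : p ≠ 0 ∨ q ≠ 0)
        (h : ovoidForm a b c x y z = p ^ 2 + p * q + q ^ 2 + shiftPoly (p * q * (p + q)) w) :
        ovoidForm a b c x y z ≠ 0 :=
      h ▸ planeForm_ne_zero hF hpq w
    simp only [mul_eq_zero] at hD
    rcases hD with (((((ha | hb) | hc) | hab) | hac) | hbc) | habc'
    · exact hplane b c x (by grind) (by simp [ovoidForm, shiftPoly, ha]; ring)
    · exact hplane a c y (by grind) (by simp [ovoidForm, shiftPoly, hb]; ring)
    · exact hplane a b z (by grind) (by simp [ovoidForm, shiftPoly, hc]; ring)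
    · obtain rfl : a = b := by grind
      refine hplane a c (x + y) (by grind) ?_
      simp only [ovoidForm, hab, mul_zero, zero_mul, shiftPoly_zero_left, shiftPoly_add_right]
      have := hF a
      have := hF c
      grind
    · obtain rfl : a = c := by grind
      refine hplane a b (x + z) (by grind) ?_
      simp only [ovoidForm, hac, mul_zero, zero_mul, shiftPoly_zero_left, shiftPoly_add_right,
        add_comm b a, mul_comm b a]
      have := hF a
      have := hF b
      grind
    · obtain rfl : b = c := by grind
      refine hplane a b (y + z) (by grind) ?_
      simp only [ovoidForm, hbc, mul_zero, zero_mul, shiftPoly_zero_left, shiftPoly_add_right]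
      have := hF a
      have := hF b
      grind
    · obtain rfl : c = a + b := by grind
      refine hplane a b (x + y + z) (by grind) ?_
      have hbc : b * (a + b) * (b + (a + b)) = a * b * (a + b) := by grind
      have hac : a * (a + b) * (a + (a + b)) = a * b * (a + b) := by grind
      simp only [ovoidForm, hbc, hac, shiftPoly_add_right]
      have := hF a
      have := hF b
      grind
  · exact ovoidForm_ne_zero_of_moore_ne_zero hF hD x y z

end CardEight


/-- Section 3.2 of the paper: the Dye ovoid for `q = 8`. -/
theorem statement19 (F : Type*) [Field F] [Fintype F] (hcard : Fintype.card F = 8)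
    (f1 f2 f3 : F → F → F → F)
    (hf1 : ∀ x y z : F, f1 x y z =
      x + y + z + x ^ 2 * y + x ^ 4 * y ^ 2 + x * y ^ 2 + x ^ 2 * y ^ 4 + x ^ 4 * y ^ 4)
    (hf2 : ∀ x y z : F, f2 x y z =
      y + x ^ 2 * z + x ^ 4 * z ^ 2 + x * z ^ 2 + x ^ 2 * z ^ 4 + x ^ 4 * z ^ 4)
    (hf3 : ∀ x y z : F, f3 x y z =
      x + y + y ^ 2 * z + y ^ 4 * z ^ 2 + y * z ^ 2 + y ^ 2 * z ^ 4 + y ^ 4 * z ^ 4) :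
    ovoidCondition f1 f2 f3 := by
  have := charP_two_of_card_eq_eight hcard
  have hF (x : F) : x ^ 8 = x := hcard ▸ FiniteField.pow_card x
  intro x1 y1 z1 x2 y2 z2 hne
  obtain ⟨a, rfl⟩ : ∃ a, x1 = x2 + a := ⟨x1 - x2, by ring⟩
  obtain ⟨b, rfl⟩ : ∃ b, y1 = y2 + b := ⟨y1 - y2, by ring⟩
  obtain ⟨c, rfl⟩ : ∃ c, z1 = z2 + c := ⟨z1 - z2, by ring⟩
  have habc : a ≠ 0 ∨ b ≠ 0 ∨ c ≠ 0 := by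
    contrapose! hne
    simp [hne]
  convert ovoidForm_ne_zero hF habc x2 y2 z2 using 1
  rw [hf1, hf1, hf2, hf2, hf3, hf3]
  have ha := hF a
  have hb := hF b
  have hc := hF c
  unfold ovoidForm shiftPoly
  clear hf1 hf2 hf3 hne habc
  grind
end
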